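/- Consider the regularized Lur'e system ẋ ∈ F(x) with F(x) := {Ax + Bu : u ∈ −ΨΨ(x)} (i.e., C = Iₙ) and suppose: A ∈ ℝ^{n×n} is diagonal with strictly negative diagonal entries; B ∈ ℝ^{n×n} is Lyapunov diagonally stable; each ψᵢ : ℝ → ℝ is nondecreasing, piecewise continuous, satisfies s·ψᵢ(s) ≥ 0 for all s ∈ ℝ, and is discontinuous at 0 with lim_{s→0⁺} ψᵢ(s) > 0 and lim_{s→0⁻} ψᵢ(s) < 0. Then the origin is globally asymptotically stable (there exists a class-KL function β such that every Krasovskii solution x : [0,T) → ℝⁿ satisfies |x(t)| ≤ β(|x(0)|, t) for all t ∈ [0,T)), and the system is state finite-time stable: for every Krasovskii solution x : [0,∞) → ℝⁿ there exists T ∈ [0,∞) such that x(t) = 0 for all t ≥ T. -/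

import Mathlib

open Matrix MeasureTheory Filter Set
open scoped ENNReal

noncomputable section

/-- Euclidean norm on `Fin m → ℝ`. -/
def euclNorm {m : ℕ} (x : Fin m → ℝ) : ℝ := Real.sqrt (∑ i, x i ^ 2)

/-- Krasovskii regularization of a scalar function `ψ` at `y`:
`Ψ(y) = ⋂_{δ>0} closure (convexHull (ψ '' [y-δ, y+δ]))`. -/
def kras (ψ : ℝ → ℝ) (y : ℝ) : Set ℝ :=
  ⋂ δ ∈ Set.Ioi (0 : ℝ), closure (convexHull ℝ (ψ '' Set.Icc (y - δ) (y + δ)))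

/-- Product (decentralized) Krasovskii regularization `ΨΨ(y) = Ψ₁(y₁) × ⋯ × Ψ_p(y_p)`. -/
def PsiSet {p : ℕ} (ψ : Fin p → ℝ → ℝ) (y : Fin p → ℝ) : Set (Fin p → ℝ) :=
  {w | ∀ i, w i ∈ kras (ψ i) (y i)}

/-- The regularized Lur'e set-valued dynamics `F(x) = {Ax + Bu : u ∈ -ΨΨ(Cx)}`. -/
def lureF {n p : ℕ} (A : Matrix (Fin n) (Fin n) ℝ) (B : Matrix (Fin n) (Fin p) ℝ)
    (C : Matrix (Fin p) (Fin n) ℝ) (ψ : Fin p → ℝ → ℝ) (x : Fin n → ℝ) :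
    Set (Fin n → ℝ) :=
  {f | ∃ u : Fin p → ℝ, (fun i => -u i) ∈ PsiSet ψ (C.mulVec x) ∧
        f = A.mulVec x + B.mulVec u}

/-- Piecewise continuity: finitely many discontinuity points on every compact
interval, and finite one-sided limits at every point. -/
def PiecewiseContinuous (f : ℝ → ℝ) : Prop :=
  (∀ a b : ℝ, {s ∈ Set.Icc a b | ¬ ContinuousAt f s}.Finite) ∧
  (∀ x : ℝ, (∃ L : ℝ, Tendsto f (nhdsWithin x (Set.Ioi x)) (nhds L)) ∧
    (∃ L : ℝ, Tendsto f (nhdsWithin x (Set.Iio x)) (nhds L)))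

/-- Sector condition: there is `ζ = 1/z ∈ (0, +∞]` (with `z = ζ⁻¹ ≥ 0`, `z = 0`
corresponding to `ζ = +∞`) such that `ψ(s)(ψ(s) - ζ s) ≤ 0` for all `s`. -/
def Sector (ψ : ℝ → ℝ) (z : ℝ) : Prop :=
  (z = 0 ∧ ∀ s : ℝ, 0 ≤ s * ψ s) ∨
  (0 < z ∧ ∀ s : ℝ, ψ s * (ψ s - (1 / z) * s) ≤ 0)

/-- Class `KL` functions. -/
def ClassKL (β : ℝ → ℝ → ℝ) : Prop :=
  (∀ t : ℝ, 0 ≤ t → ContinuousOn (fun s => β s t) (Set.Ici 0) ∧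
    StrictMonoOn (fun s => β s t) (Set.Ici 0) ∧ β 0 t = 0) ∧
  (∀ s : ℝ, 0 ≤ s → AntitoneOn (fun t => β s t) (Set.Ici 0) ∧
    Tendsto (fun t => β s t) atTop (nhds 0))

/-- Class `K∞` functions. -/
def ClassKInf (α : ℝ → ℝ) : Prop :=
  ContinuousOn α (Set.Ici 0) ∧ StrictMonoOn α (Set.Ici 0) ∧ α 0 = 0 ∧
  Tendsto α atTop atTop

/-- A Krasovskii solution of `ẋ ∈ F(x)` on a time set `s` (a locally absolutely
continuous function whose derivative belongs to `F(x(t))` almost everywhere),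
formalized through the integral representation `x(t) = x(0) + ∫₀ᵗ f(τ) dτ`
with `f(τ) ∈ F(x(τ))` for a.e. `τ ∈ s`. -/
def IsKrasovskiiSolutionOn {n : ℕ} (F : (Fin n → ℝ) → Set (Fin n → ℝ))
    (x : ℝ → Fin n → ℝ) (s : Set ℝ) : Prop :=
  ∃ f : ℝ → Fin n → ℝ,
    (∀ t ∈ s, IntervalIntegrable f volume 0 t) ∧
    (∀ᵐ t ∂volume, t ∈ s → f t ∈ F (x t)) ∧
    ∀ t ∈ s, x t = x 0 + ∫ τ in (0:ℝ)..t, f τ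

/-- The time interval `[0, T)` with `T ∈ (0, +∞]`. -/
def timeItv (T : ℝ≥0∞) : Set ℝ := {t : ℝ | 0 ≤ t ∧ ENNReal.ofReal t < T}

/-- Global asymptotic stability of the origin: a class-`KL` bound holds along
every Krasovskii solution on every time interval `[0, T)`. -/
def GASOrigin {n p : ℕ} (A : Matrix (Fin n) (Fin n) ℝ) (B : Matrix (Fin n) (Fin p) ℝ)
    (C : Matrix (Fin p) (Fin n) ℝ) (ψ : Fin p → ℝ → ℝ) : Prop :=
  ∃ β : ℝ → ℝ → ℝ, ClassKL β ∧
    ∀ T : ℝ≥0∞, ∀ x : ℝ → Fin n → ℝ,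
      IsKrasovskiiSolutionOn (lureF A B C ψ) x (timeItv T) →
      ∀ t ∈ timeItv T, euclNorm (x t) ≤ β (euclNorm (x 0)) t

theorem le_of_mem_kras {ψ : ℝ → ℝ} (hψ : Monotone ψ) {v y s : ℝ} (hv : v ∈ kras ψ y)
    (hs : y < s) : v ≤ ψ s := by
  have h := mem_iInter₂.1 hv (s - y) (sub_pos.2 hs)
  refine closure_minimal (convexHull_min ?_ (convex_Iic (ψ s))) isClosed_Iic h
  rintro _ ⟨r, hr, rfl⟩
  exact hψ (by linarith [hr.2])

theorem ge_of_mem_kras {ψ : ℝ → ℝ} (hψ : Monotone ψ) {v y s : ℝ} (hv : v ∈ kras ψ y)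
    (hs : s < y) : ψ s ≤ v := by
  have h := mem_iInter₂.1 hv (y - s) (sub_pos.2 hs)
  refine closure_minimal (convexHull_min ?_ (convex_Ici (ψ s))) isClosed_Ici h
  rintro _ ⟨r, hr, rfl⟩
  exact hψ (by linarith [hr.1])

/-- The primitive of `ψ` vanishing at `0`. -/
def primitive (ψ : ℝ → ℝ) (z : ℝ) : ℝ := ∫ s in (0 : ℝ)..z, ψ s

theorem primitive_zero (ψ : ℝ → ℝ) : primitive ψ 0 = 0 := by simp [primitive]

theorem primitive_sub {ψ : ℝ → ℝ} (hψ : Monotone ψ) (y z : ℝ) :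
    primitive ψ z - primitive ψ y = ∫ s in y..z, ψ s :=
  intervalIntegral.integral_interval_sub_left hψ.intervalIntegrable hψ.intervalIntegrable

/-- The subgradient inequality for the convex function `primitive ψ`. -/
theorem mul_sub_le_primitive_sub {ψ : ℝ → ℝ} (hψ : Monotone ψ) {v y : ℝ}
    (h₁ : ∀ s, y < s → v ≤ ψ s) (h₂ : ∀ s, s < y → ψ s ≤ v) (z : ℝ) :
    v * (z - y) ≤ primitive ψ z - primitive ψ y := by
  rw [primitive_sub hψ]
  rcases le_total y z with h | h
  · have := intervalIntegral.integral_mono_on_of_le_Ioo (μ := volume) h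
      (intervalIntegrable_const (c := v)) (hψ.intervalIntegrable (a := y) (b := z))
      (fun s hs => h₁ s hs.1)
    simp only [intervalIntegral.integral_const, smul_eq_mul] at this
    linarith
  · have := intervalIntegral.integral_mono_on_of_le_Ioo (μ := volume) h
      (hψ.intervalIntegrable (a := z) (b := y)) (intervalIntegrable_const (c := v))
      (fun s hs => h₂ s hs.2)
    simp only [intervalIntegral.integral_const, smul_eq_mul] at this
    rw [intervalIntegral.integral_symm]
    linarith

theorem continuous_primitive_of_monotone {ψ : ℝ → ℝ} (hψ : Monotone ψ) :
    Continuous (primitive ψ) :=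
  intervalIntegral.continuous_primitive (fun _ _ => hψ.intervalIntegrable) 0

theorem lipschitzOnWith_primitive {ψ : ℝ → ℝ} (hψ : Monotone ψ) (R : ℝ) :
    ∃ K, LipschitzOnWith K (primitive ψ) (Icc (-R) R) := by
  refine ⟨Real.toNNReal (max |ψ (-R)| |ψ R|), LipschitzOnWith.of_dist_le_mul ?_⟩
  intro z hz y hy
  rw [Real.dist_eq, Real.dist_eq, primitive_sub hψ, Real.coe_toNNReal _ (by positivity),
    ← Real.norm_eq_abs]
  refine intervalIntegral.norm_integral_le_of_norm_le_const fun s hs => ?_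
  have hs' : s ∈ Icc (-R) R := (ordConnected_Icc.uIcc_subset hy hz) (uIoc_subset_uIcc hs)
  exact abs_le_max_abs_abs (hψ hs'.1) (hψ hs'.2)

theorem LipschitzOnWith.comp_absolutelyContinuousOnInterval {φ f : ℝ → ℝ} {K : NNReal}
    {S : Set ℝ} {a b : ℝ} (hφ : LipschitzOnWith K φ S)
    (hf : AbsolutelyContinuousOnInterval f a b) (hS : MapsTo f (uIcc a b) S) :
    AbsolutelyContinuousOnInterval (fun t => φ (f t)) a b := by
  rw [absolutelyContinuousOnInterval_iff] at hf ⊢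
  intro ε hε
  obtain ⟨δ, hδ, h⟩ := hf (ε / (K + 1)) (by positivity)
  refine ⟨δ, hδ, fun E hE hlt => ?_⟩
  have hE' := h E hE hlt
  have hmem := hE.1
  calc ∑ i ∈ Finset.range E.1, dist (φ (f (E.2 i).1)) (φ (f (E.2 i).2))
      ≤ ∑ i ∈ Finset.range E.1, (K : ℝ) * dist (f (E.2 i).1) (f (E.2 i).2) :=
        Finset.sum_le_sum fun i hi =>
          hφ.dist_le_mul _ (hS (hmem i hi).1) _ (hS (hmem i hi).2)
    _ = K * ∑ i ∈ Finset.range E.1, dist (f (E.2 i).1) (f (E.2 i).2) := by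
        rw [Finset.mul_sum]
    _ ≤ K * (ε / (K + 1)) := by gcongr
    _ < ε := by
        rw [mul_div_assoc', div_lt_iff₀ (by positivity)]
        nlinarith [K.coe_nonneg]

theorem absolutelyContinuousOnInterval_sum {ι : Type*} (s : Finset ι) {f : ι → ℝ → ℝ} {a b : ℝ}
    (hf : ∀ i ∈ s, AbsolutelyContinuousOnInterval (f i) a b) :
    AbsolutelyContinuousOnInterval (fun t => ∑ i ∈ s, f i t) a b := by
  have h : AbsolutelyContinuousOnInterval (∑ i ∈ s, f i) a b :=
    Finset.sum_induction f (fun h => AbsolutelyContinuousOnInterval h a b)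
      (fun _ _ h₁ h₂ => h₁.add h₂)
      ((LipschitzWith.const (0 : ℝ)).lipschitzOnWith.absolutelyContinuousOnInterval) hf
  convert h using 1
  ext t
  simp

theorem AbsolutelyContinuousOnInterval.primitive_comp {ψ y : ℝ → ℝ} (hψ : Monotone ψ) {a b : ℝ}
    (hy : AbsolutelyContinuousOnInterval y a b) :
    AbsolutelyContinuousOnInterval (fun t => primitive ψ (y t)) a b := by
  obtain ⟨R, hR⟩ := hy.exists_bound
  obtain ⟨K, hK⟩ := lipschitzOnWith_primitive hψ R
  exact hK.comp_absolutelyContinuousOnInterval hy fun t ht => abs_le.1 (hR t ht)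

/-- Chain rule for `primitive ψ` along a differentiable curve, with any Krasovskii selection. -/
theorem HasDerivAt.primitive_comp {ψ y : ℝ → ℝ} (hψ : Monotone ψ) {t y' v : ℝ}
    (hy : HasDerivAt y y' t) (hd : DifferentiableAt ℝ (fun s => primitive ψ (y s)) t)
    (hv : v ∈ kras ψ (y t)) : HasDerivAt (fun s => primitive ψ (y s)) (v * y') t := by
  have hmin : IsLocalMin (fun s => primitive ψ (y s) - v * y s) t :=
    Eventually.of_forall fun s => by
      have := mul_sub_le_primitive_sub hψ (fun _ => le_of_mem_kras hψ hv)
        (fun _ => ge_of_mem_kras hψ hv) (y s)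
      show _ - _ ≤ _ - _
      linarith
  have h := hmin.hasDerivAt_eq_zero (hd.hasDerivAt.sub (hy.const_mul v))
  rw [← sub_eq_zero.1 h]
  exact hd.hasDerivAt

/-- The Lur'e–Postnikov function `∑ gᵢ ∫₀^{xᵢ} ψᵢ`. -/
def lurePostnikov {n : ℕ} (g : Fin n → ℝ) (ψ : Fin n → ℝ → ℝ) (x : Fin n → ℝ) : ℝ :=
  ∑ i, g i * primitive (ψ i) (x i)

theorem lurePostnikov_sub_le {n : ℕ} (g : Fin n → ℝ) {ψ : Fin n → ℝ → ℝ}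
    (hψ : ∀ i, Monotone (ψ i)) {x f : ℝ → Fin n → ℝ} {a b T c : ℝ} (ha : 0 ≤ a) (hab : a ≤ b)
    (hbT : b ≤ T) (hf : IntervalIntegrable f volume 0 T)
    (hx : ∀ t ∈ Icc 0 T, x t = x 0 + ∫ τ in (0 : ℝ)..t, f τ)
    (hc : ∀ᵐ t, t ∈ Icc a b → ∃ v ∈ PsiSet ψ (x t), ∑ i, g i * (v i * f t i) ≤ -c) :
    lurePostnikov g ψ (x b) - lurePostnikov g ψ (x a) ≤ -c * (b - a) := by
  have hT : 0 ≤ T := ha.trans (hab.trans hbT)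
  have hfi : ∀ i, IntervalIntegrable (fun t => f t i) volume 0 T := fun i =>
    ⟨hf.1.eval i, hf.2.eval i⟩
  set y : Fin n → ℝ → ℝ := fun i t => x 0 i + ∫ τ in (0 : ℝ)..t, f τ i with hy
  have hxy : ∀ t ∈ Icc 0 T, ∀ i, x t i = y i t := fun t ht i => by
    have hft : IntervalIntegrable f volume 0 t := hf.mono_set (by
      rw [uIcc_of_le hT, uIcc_of_le ht.1]; exact Icc_subset_Icc_right ht.2)
    rw [hx t ht, hy, Pi.add_apply]
    congr 1
    exact ((ContinuousLinearMap.proj (R := ℝ) (φ := fun _ : Fin n => ℝ) i).intervalIntegral_comp_comm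
      hft).symm
  have hyac : ∀ i, AbsolutelyContinuousOnInterval (y i) 0 T := fun i =>
    ((LipschitzWith.const (x 0 i)).lipschitzOnWith.absolutelyContinuousOnInterval).add
      ((hfi i).absolutelyContinuousOnInterval_intervalIntegral (by simp))
  have hpac : ∀ i, AbsolutelyContinuousOnInterval (fun t => primitive (ψ i) (y i t)) 0 T :=
    fun i => (hyac i).primitive_comp (hψ i)
  have hVac : AbsolutelyContinuousOnInterval
      (fun t => ∑ i, g i * primitive (ψ i) (y i t)) a b :=
    (absolutelyContinuousOnInterval_sum _ fun i _ => (hpac i).const_mul (g i)).mono (by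
      rw [uIcc_of_le hT, uIcc_of_le hab]; exact Icc_subset_Icc ha hbT)
  have hV : ∀ t ∈ Icc 0 T, lurePostnikov g ψ (x t) = ∑ i, g i * primitive (ψ i) (y i t) :=
    fun t ht => by simp only [lurePostnikov, hxy t ht]
  rw [hV b ⟨ha.trans hab, hbT⟩, hV a ⟨ha, hab.trans hbT⟩, ← hVac.integral_deriv_eq_sub]
  have hconst : ∫ _ in a..b, -c = -c * (b - a) := by simp [mul_comm]
  rw [← hconst]
  refine intervalIntegral.integral_mono_ae_restrict hab hVac.intervalIntegrable_deriv
    intervalIntegrable_const ?_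
  rw [EventuallyLE, ae_restrict_iff' measurableSet_Icc]
  have hd₁ := ae_all_iff.2 fun i => (hfi i).ae_hasDerivAt_integral
  have hd₂ := ae_all_iff.2 fun i => (hpac i).ae_differentiableAt
  filter_upwards [hc, hd₁, hd₂] with t ht h₁ h₂ htab
  have htT : t ∈ Icc 0 T := ⟨ha.trans htab.1, htab.2.trans hbT⟩
  have htT' : t ∈ uIcc 0 T := by rwa [uIcc_of_le hT]
  obtain ⟨v, hv, hle⟩ := ht htab
  have hder : HasDerivAt (fun t => ∑ i, g i * primitive (ψ i) (y i t))
      (∑ i, g i * (v i * f t i)) t := by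
    refine HasDerivAt.fun_sum fun i _ => HasDerivAt.const_mul _ ?_
    refine HasDerivAt.primitive_comp (hψ i) ?_ (h₂ i htT') (hxy t htT i ▸ hv i)
    exact (h₁ i htT' 0 (by simp)).const_add _
  rw [hder.deriv]
  exact hle

theorem exists_pos_forall_le {n : ℕ} {p : Fin n → ℝ} (hp : ∀ i, 0 < p i) :
    ∃ a, 0 < a ∧ ∀ i, a ≤ p i := by
  obtain ⟨a, ha, h⟩ := (finite_univ (α := Fin n)).isCompact.exists_forall_le'
    (continuous_of_discreteTopology (f := p)).continuousOn (fun i _ => hp i)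
  exact ⟨a, ha, fun i => h i (mem_univ i)⟩

/-- Coercivity of the quadratic form associated with a Lyapunov diagonally stable matrix. -/
theorem exists_pos_mul_sq_norm_le {n : ℕ} {B : Matrix (Fin n) (Fin n) ℝ} {g : Fin n → ℝ}
    (h : ∀ u : Fin n → ℝ, u ≠ 0 →
      0 < u ⬝ᵥ ((Matrix.diagonal g * B + Bᵀ * Matrix.diagonal g).mulVec u)) :
    ∃ m, 0 < m ∧ ∀ v : Fin n → ℝ, m * ‖v‖ ^ 2 ≤ ∑ i, g i * (v i * B.mulVec v i) := by
  have hq : ∀ v : Fin n → ℝ, 2 * ∑ i, g i * (v i * B.mulVec v i) =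
      v ⬝ᵥ ((Matrix.diagonal g * B + Bᵀ * Matrix.diagonal g).mulVec v) := fun v => by
    rw [add_mulVec, dotProduct_add, ← mulVec_mulVec, ← mulVec_mulVec, dotProduct_mulVec v Bᵀ,
      vecMul_transpose, two_mul]
    simp only [dotProduct, mulVec_diagonal]
    congr 1 <;> exact Finset.sum_congr rfl fun i _ => by ring
  obtain ⟨m, hm, hmle⟩ := (isCompact_sphere (0 : Fin n → ℝ) 1).exists_forall_le'
    (f := fun v => ∑ i, g i * (v i * B.mulVec v i)) (a := 0)
    (by
      refine Continuous.continuousOn ?_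
      simp only [mulVec, dotProduct]
      fun_prop)
    (fun v hv => by
      have h0 : v ≠ 0 := by
        rintro rfl
        simp at hv
      linarith [h v h0, hq v])
  refine ⟨m, hm, fun v => ?_⟩
  rcases eq_or_ne v 0 with rfl | hv
  · simp
  have hn : 0 < ‖v‖ := norm_pos_iff.2 hv
  have h1 := hmle (‖v‖⁻¹ • v) (by simp [norm_smul, hn.ne'])
  have h2 : ∑ i, g i * ((‖v‖⁻¹ • v) i * B.mulVec (‖v‖⁻¹ • v) i) =
      (‖v‖ ^ 2)⁻¹ * ∑ i, g i * (v i * B.mulVec v i) := by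
    rw [Finset.mul_sum]
    refine Finset.sum_congr rfl fun i _ => ?_
    simp only [mulVec_smul, Pi.smul_apply, smul_eq_mul]
    ring
  simp only [h2] at h1
  rwa [inv_mul_eq_div, le_div_iff₀ (by positivity)] at h1

theorem exists_pos_forall_jump {n : ℕ} {ψ : Fin n → ℝ → ℝ} (hmono : ∀ i, Monotone (ψ i))
    (hpos : ∀ i, ∃ L : ℝ, 0 < L ∧ Tendsto (ψ i) (nhdsWithin 0 (Ioi 0)) (nhds L))
    (hneg : ∀ i, ∃ L : ℝ, L < 0 ∧ Tendsto (ψ i) (nhdsWithin 0 (Iio 0)) (nhds L)) :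
    ∃ ℓ, 0 < ℓ ∧ ∀ i, (∀ s, 0 < s → ℓ ≤ ψ i s) ∧ ∀ s, s < 0 → ψ i s ≤ -ℓ := by
  choose L hL hLt using hpos
  choose M hM hMt using hneg
  obtain ⟨ℓ, hℓ, h⟩ := exists_pos_forall_le (p := fun i => min (L i) (-M i))
    fun i => lt_min (hL i) (neg_pos.2 (hM i))
  refine ⟨ℓ, hℓ, fun i => ⟨fun s hs => ?_, fun s hs => ?_⟩⟩
  · refine ((h i).trans (min_le_left _ _)).trans (le_of_tendsto (hLt i) ?_)
    filter_upwards [Ioo_mem_nhdsGT hs] with r hr using hmono i hr.2.le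
  · have hs' : ψ i s ≤ M i := by
      refine ge_of_tendsto (hMt i) ?_
      filter_upwards [Ioo_mem_nhdsLT hs] with r hr using hmono i hr.1.le
    linarith [(h i).trans (min_le_right _ _)]

theorem mul_abs_le_primitive {ψ : ℝ → ℝ} (hψ : Monotone ψ) {ℓ : ℝ} (hℓ : 0 ≤ ℓ)
    (h₁ : ∀ s, 0 < s → ℓ ≤ ψ s) (h₂ : ∀ s, s < 0 → ψ s ≤ -ℓ) (z : ℝ) :
    ℓ * |z| ≤ primitive ψ z := by
  have hp := mul_sub_le_primitive_sub hψ (v := ℓ) (y := 0) h₁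
    (fun s hs => (h₂ s hs).trans (by linarith)) z
  have hn := mul_sub_le_primitive_sub hψ (v := -ℓ) (y := 0)
    (fun s hs => le_trans (by linarith) (h₁ s hs)) h₂ z
  rw [primitive_zero] at hp hn
  rcases abs_cases z with ⟨h, -⟩ | ⟨h, -⟩ <;> rw [h] <;> linarith

theorem primitive_monotoneOn {ψ : ℝ → ℝ} (hψ : Monotone ψ) (h₁ : ∀ s, 0 < s → 0 ≤ ψ s)
    (h₂ : ∀ s, s < 0 → ψ s ≤ 0) : MonotoneOn (primitive ψ) (Ici 0) := by
  intro y hy z _ hyz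
  rcases (mem_Ici.1 hy).eq_or_lt with rfl | hy
  · have := mul_sub_le_primitive_sub hψ h₁ h₂ z
    linarith
  · have := mul_sub_le_primitive_sub hψ (fun s (hs : y < s) => hψ hs.le)
      (fun s hs => hψ hs.le) z
    nlinarith [h₁ y hy]

theorem primitive_antitoneOn {ψ : ℝ → ℝ} (hψ : Monotone ψ) (h₁ : ∀ s, 0 < s → 0 ≤ ψ s)
    (h₂ : ∀ s, s < 0 → ψ s ≤ 0) : AntitoneOn (primitive ψ) (Iic 0) := by
  intro z _ y hy hzy
  rcases (mem_Iic.1 hy).eq_or_lt with rfl | hy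
  · have := mul_sub_le_primitive_sub hψ h₁ h₂ z
    linarith
  · have := mul_sub_le_primitive_sub hψ (fun s (hs : y < s) => hψ hs.le)
      (fun s hs => hψ hs.le) z
    nlinarith [h₂ y hy]

theorem abs_le_euclNorm {n : ℕ} (x : Fin n → ℝ) (i : Fin n) : |x i| ≤ euclNorm x :=
  Real.abs_le_sqrt (Finset.single_le_sum (f := fun i => x i ^ 2) (fun _ _ => sq_nonneg _)
    (Finset.mem_univ i))

theorem euclNorm_le_sum_abs {n : ℕ} (x : Fin n → ℝ) : euclNorm x ≤ ∑ i, |x i| := by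
  refine Real.sqrt_le_iff.2 ⟨Finset.sum_nonneg fun _ _ => abs_nonneg _, ?_⟩
  simpa only [sq_abs] using Finset.sum_sq_le_sq_sum_of_nonneg (s := Finset.univ)
    (f := fun i => |x i|) fun _ _ => abs_nonneg _

theorem lurePostnikov_dissipation {n : ℕ} {B : Matrix (Fin n) (Fin n) ℝ}
    {ψ : Fin n → ℝ → ℝ} {d g : Fin n → ℝ} {ℓ m : ℝ} (hd : ∀ i, d i < 0) (hg : ∀ i, 0 < g i)
    (hmono : ∀ i, Monotone (ψ i)) (hℓ : 0 < ℓ)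
    (hjump : ∀ i, (∀ s, 0 < s → ℓ ≤ ψ i s) ∧ ∀ s, s < 0 → ψ i s ≤ -ℓ) (hm : 0 < m)
    (hB : ∀ v : Fin n → ℝ, m * ‖v‖ ^ 2 ≤ ∑ i, g i * (v i * B.mulVec v i))
    {x f : Fin n → ℝ} (hf : f ∈ lureF (Matrix.diagonal d) B 1 ψ x) :
    ∃ v ∈ PsiSet ψ x, ∑ i, g i * (v i * f i) ≤ 0 ∧
      (x ≠ 0 → ∑ i, g i * (v i * f i) ≤ -(m * ℓ ^ 2)) := by
  obtain ⟨u, hu, rfl⟩ := hf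
  rw [one_mulVec] at hu
  set v : Fin n → ℝ := fun i => -u i with hv
  have huv : u = -v := by ext i; simp [hv]
  have hsign : ∀ i, (0 < x i → ℓ ≤ v i) ∧ (x i < 0 → v i ≤ -ℓ) := fun i =>
    ⟨fun hx => ((hjump i).1 _ (half_pos hx)).trans
        (ge_of_mem_kras (hmono i) (hu i) (half_lt_self hx)),
      fun hx => (le_of_mem_kras (hmono i) (hu i) (s := x i / 2) (by linarith)).trans
        ((hjump i).2 _ (by linarith))⟩
  have hle : ∑ i, g i * (v i * ((Matrix.diagonal d).mulVec x + B.mulVec u) i) ≤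
      -(m * ‖v‖ ^ 2) := by
    have hsplit : ∑ i, g i * (v i * ((Matrix.diagonal d).mulVec x + B.mulVec u) i) =
        ∑ i, g i * d i * (v i * x i) - ∑ i, g i * (v i * B.mulVec v i) := by
      rw [← Finset.sum_sub_distrib]
      refine Finset.sum_congr rfl fun i _ => ?_
      rw [huv, mulVec_neg, Pi.add_apply, mulVec_diagonal, Pi.neg_apply]
      ring
    have hnonpos : ∑ i, g i * d i * (v i * x i) ≤ 0 := Finset.sum_nonpos fun i _ => by
      refine mul_nonpos_of_nonpos_of_nonneg (mul_neg_of_pos_of_neg (hg i) (hd i)).le ?_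
      rcases lt_trichotomy (x i) 0 with h | h | h
      · exact mul_nonneg_of_nonpos_of_nonpos (by linarith [(hsign i).2 h]) h.le
      · simp [h]
      · exact mul_nonneg (hℓ.le.trans ((hsign i).1 h)) h.le
    linarith [hB v]
  refine ⟨v, hu, hle.trans (neg_nonpos.2 (by positivity)), fun hx => hle.trans ?_⟩
  obtain ⟨i, hi⟩ := Function.ne_iff.1 hx
  have hvi : ℓ ≤ ‖v‖ := by
    refine le_trans ?_ (norm_le_pi_norm v i)
    rw [Real.norm_eq_abs]
    rcases lt_or_gt_of_ne hi with h | h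
    · exact le_abs.2 (Or.inr (by linarith [(hsign i).2 h]))
    · exact le_abs.2 (Or.inl ((hsign i).1 h))
  gcongr

/-- The Lur'e–Postnikov function decays at a uniform rate until it vanishes. -/
theorem lurePostnikov_le_max {n : ℕ} {F : (Fin n → ℝ) → Set (Fin n → ℝ)}
    {ψ : Fin n → ℝ → ℝ} {g : Fin n → ℝ} {c : ℝ} (hmono : ∀ i, Monotone (ψ i))
    (hF : ∀ x, ∀ f ∈ F x, ∃ v ∈ PsiSet ψ x, ∑ i, g i * (v i * f i) ≤ 0 ∧
      (x ≠ 0 → ∑ i, g i * (v i * f i) ≤ -c))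
    {x : ℝ → Fin n → ℝ} {s : Set ℝ} (hx : IsKrasovskiiSolutionOn F x s) {t : ℝ} (ht : 0 ≤ t)
    (hs : Icc 0 t ⊆ s) :
    lurePostnikov g ψ (x t) ≤ max 0 (lurePostnikov g ψ (x 0) - c * t) := by
  obtain ⟨f, hfi, hfF, hxf⟩ := hx
  have hft := hfi t (hs (right_mem_Icc.2 ht))
  have hxt : ∀ τ ∈ Icc 0 t, x τ = x 0 + ∫ r in (0 : ℝ)..τ, f r := fun τ hτ => hxf τ (hs hτ)
  by_cases h : ∃ r ∈ Icc 0 t, x r = 0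
  · obtain ⟨r, hr, hr0⟩ := h
    have := lurePostnikov_sub_le g hmono (c := 0) hr.1 hr.2 le_rfl hft hxt (by
      filter_upwards [hfF] with τ hτ hτr
      obtain ⟨v, hv, h, -⟩ := hF _ _ (hτ (hs ⟨hr.1.trans hτr.1, hτr.2⟩))
      exact ⟨v, hv, by simpa using h⟩)
    have h0 : lurePostnikov g ψ (x r) = 0 := by
      simp [lurePostnikov, hr0, primitive_zero]
    exact le_max_of_le_left (by linarith)
  · push Not at h
    have := lurePostnikov_sub_le g hmono (c := c) le_rfl ht le_rfl hft hxt (by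
      filter_upwards [hfF] with τ hτ hτr
      obtain ⟨v, hv, -, h'⟩ := hF _ _ (hτ (hs hτr))
      exact ⟨v, hv, h' (h τ hτr)⟩)
    exact le_max_of_le_right (by linarith)

theorem classKL_of_linear_decay {α : ℝ → ℝ} (hα : Continuous α) (hα0 : α 0 = 0)
    (hαm : MonotoneOn α (Ici 0)) {K c : ℝ} (hK : 0 ≤ K) (hc : 0 < c) :
    ClassKL fun s t => K * max 0 (α s - c * t) + s / (1 + t) := by
  refine ⟨fun t ht => ⟨?_, ?_, ?_⟩, fun s hs => ⟨?_, ?_⟩⟩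
  · exact Continuous.continuousOn (by fun_prop)
  · intro s hs r hr hsr
    have h1 : α s ≤ α r := hαm hs hr hsr.le
    have h2 : s / (1 + t) < r / (1 + t) := by gcongr
    have h3 : K * max 0 (α s - c * t) ≤ K * max 0 (α r - c * t) := by gcongr
    exact add_lt_add_of_le_of_lt h3 h2
  · have : max 0 (α 0 - c * t) = 0 := max_eq_left (by rw [hα0]; nlinarith)
    simp [this]
  · intro t ht r _ htr
    have h0 : (0 : ℝ) ≤ t := ht
    have h0' : (0 : ℝ) ≤ s := hs
    show K * max 0 (α s - c * r) + s / (1 + r) ≤ K * max 0 (α s - c * t) + s / (1 + t)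
    gcongr
  · have h1 : Tendsto (fun t : ℝ => K * max 0 (α s - c * t)) atTop (nhds 0) := by
      refine tendsto_const_nhds.congr' ?_
      filter_upwards [eventually_ge_atTop (α s / c)] with t ht
      rw [div_le_iff₀ hc] at ht
      rw [max_eq_left (by linarith), mul_zero]
    have h2 : Tendsto (fun t : ℝ => s / (1 + t)) atTop (nhds 0) :=
      tendsto_const_nhds.div_atTop (tendsto_atTop_add_const_left _ _ tendsto_id)
    simpa using h1.add h2

theorem sum_abs_le_mul_lurePostnikov {n : ℕ} {ψ : Fin n → ℝ → ℝ} {g : Fin n → ℝ} {a ℓ : ℝ}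
    (hmono : ∀ i, Monotone (ψ i)) (ha : 0 < a) (hag : ∀ i, a ≤ g i) (hℓ : 0 < ℓ)
    (hjump : ∀ i, (∀ s, 0 < s → ℓ ≤ ψ i s) ∧ ∀ s, s < 0 → ψ i s ≤ -ℓ) (x : Fin n → ℝ) :
    ∑ i, |x i| ≤ (a * ℓ)⁻¹ * lurePostnikov g ψ x := by
  rw [inv_mul_eq_div, le_div_iff₀ (by positivity), Finset.sum_mul]
  refine Finset.sum_le_sum fun i _ => ?_
  have := mul_abs_le_primitive (hmono i) hℓ.le (hjump i).1 (hjump i).2 (x i)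
  calc |x i| * (a * ℓ) = a * (ℓ * |x i|) := by ring
    _ ≤ g i * primitive (ψ i) (x i) :=
      mul_le_mul (hag i) this (by positivity) (ha.le.trans (hag i))

/-- cellular neural networks: with `C = Iₙ`, `A` diagonal
negative definite, `B` Lyapunov diagonally stable and sector-bounded
nondecreasing nonlinearities discontinuous at `0`, the origin is GAS and the
system is state finite-time stable. -/
theorem stmt13 {n : ℕ} (A B : Matrix (Fin n) (Fin n) ℝ) (ψ : Fin n → ℝ → ℝ)
    (d : Fin n → ℝ)
    (hA : A = Matrix.diagonal d) (hd : ∀ i, d i < 0)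
    (hLDS : ∃ g : Fin n → ℝ, (∀ i, 0 < g i) ∧
      ∀ u : Fin n → ℝ, u ≠ 0 →
        0 < u ⬝ᵥ ((Matrix.diagonal g * B + Bᵀ * Matrix.diagonal g).mulVec u))
    (hmono : ∀ i, Monotone (ψ i))
    (hpc : ∀ i, PiecewiseContinuous (ψ i))
    (hsec : ∀ i, ∀ s : ℝ, 0 ≤ s * ψ i s)
    (hdisc : ∀ i, ¬ ContinuousAt (ψ i) 0 ∧
      (∃ L : ℝ, 0 < L ∧ Tendsto (ψ i) (nhdsWithin 0 (Set.Ioi 0)) (nhds L)) ∧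
      (∃ L : ℝ, L < 0 ∧ Tendsto (ψ i) (nhdsWithin 0 (Set.Iio 0)) (nhds L))) :
    GASOrigin A B (1 : Matrix (Fin n) (Fin n) ℝ) ψ ∧
      ∀ x : ℝ → Fin n → ℝ,
        IsKrasovskiiSolutionOn (lureF A B (1 : Matrix (Fin n) (Fin n) ℝ) ψ) x
          (Set.Ici 0) →
        ∃ T : ℝ, 0 ≤ T ∧ ∀ t : ℝ, T ≤ t → x t = 0 := by
  obtain ⟨g, hg, hq⟩ := hLDS
  obtain ⟨m, hm, hB⟩ := exists_pos_mul_sq_norm_le hq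
  obtain ⟨ℓ, hℓ, hjump⟩ :=
    exists_pos_forall_jump hmono (fun i => (hdisc i).2.1) (fun i => (hdisc i).2.2)
  obtain ⟨a, ha, hag⟩ := exists_pos_forall_le hg
  have hc : 0 < m * ℓ ^ 2 := by positivity
  have hK : 0 < (a * ℓ)⁻¹ := by positivity
  have hlow := sum_abs_le_mul_lurePostnikov hmono ha hag hℓ hjump
  have hdecay : ∀ {x : ℝ → Fin n → ℝ} {s : Set ℝ}, IsKrasovskiiSolutionOn (lureF A B 1 ψ) x s →
      ∀ {t : ℝ}, 0 ≤ t → Icc 0 t ⊆ s →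
      lurePostnikov g ψ (x t) ≤ max 0 (lurePostnikov g ψ (x 0) - m * ℓ ^ 2 * t) :=
    fun hx _ ht hs => lurePostnikov_le_max hmono
      (fun _ _ hf => lurePostnikov_dissipation hd hg hmono hℓ hjump hm hB (hA ▸ hf)) hx ht hs
  have h₁ : ∀ i s, 0 < s → 0 ≤ ψ i s := fun i s hs => hℓ.le.trans ((hjump i).1 s hs)
  have h₂ : ∀ i s, s < 0 → ψ i s ≤ 0 := fun i s hs => ((hjump i).2 s hs).trans (by linarith)
  have hup := fun i => primitive_monotoneOn (hmono i) (h₁ i) (h₂ i)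
  have hdown := fun i => primitive_antitoneOn (hmono i) (h₁ i) (h₂ i)
  refine ⟨?_, fun x hx => ?_⟩
  · set α : ℝ → ℝ := fun s => ∑ i, g i * (primitive (ψ i) s + primitive (ψ i) (-s)) with hα
    have hcont : Continuous α := continuous_finsetSum _ fun i _ => by
      have := continuous_primitive_of_monotone (hmono i)
      fun_prop
    have hmonoα : MonotoneOn α (Ici 0) := fun s hs r hr hsr =>
      Finset.sum_le_sum fun i _ => mul_le_mul_of_nonneg_left
        (add_le_add (hup i hs hr hsr) (hdown i (mem_Iic.2 (neg_nonpos.2 (mem_Ici.1 hr)))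
          (mem_Iic.2 (neg_nonpos.2 (mem_Ici.1 hs))) (neg_le_neg hsr))) (hg i).le
    have hVα : ∀ x : Fin n → ℝ, lurePostnikov g ψ x ≤ α (euclNorm x) := fun x =>
      Finset.sum_le_sum fun i _ => mul_le_mul_of_nonneg_left (by
        have hx := abs_le.1 (abs_le_euclNorm x i)
        have h0 : 0 ≤ euclNorm x := Real.sqrt_nonneg _
        have hp := hup i (mem_Ici.2 le_rfl) (mem_Ici.2 h0) h0
        have hn := hdown i (mem_Iic.2 (neg_nonpos.2 h0)) (mem_Iic.2 le_rfl) (neg_nonpos.2 h0)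
        rw [primitive_zero] at hp hn
        rcases le_total 0 (x i) with h | h
        · linarith [hup i h (mem_Ici.2 h0) hx.2]
        · linarith [hdown i (mem_Iic.2 (neg_nonpos.2 h0)) h hx.1]) (hg i).le
    refine ⟨_, classKL_of_linear_decay hcont (by simp [hα, primitive_zero]) hmonoα hK.le hc,
      fun T x hx t ht => ?_⟩
    have hV := hdecay hx ht.1 fun τ hτ =>
      ⟨hτ.1, (ENNReal.ofReal_le_ofReal hτ.2).trans_lt ht.2⟩
    have h0 : 0 ≤ euclNorm (x 0) / (1 + t) :=
      div_nonneg (Real.sqrt_nonneg _) (by linarith [ht.1])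
    calc euclNorm (x t) ≤ (a * ℓ)⁻¹ * lurePostnikov g ψ (x t) :=
          (euclNorm_le_sum_abs _).trans (hlow _)
      _ ≤ (a * ℓ)⁻¹ * max 0 (α (euclNorm (x 0)) - m * ℓ ^ 2 * t) := by
          gcongr
          exact hV.trans (max_le_max le_rfl (sub_le_sub_right (hVα _) _))
      _ ≤ _ := le_add_of_nonneg_right h0
  · refine ⟨max 0 (lurePostnikov g ψ (x 0) / (m * ℓ ^ 2)), le_max_left _ _, fun t ht => ?_⟩
    have hV := hdecay hx ((le_max_left _ _).trans ht) Icc_subset_Ici_self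
    have ht' := (div_le_iff₀ hc).1 ((le_max_right _ _).trans ht)
    rw [max_eq_left (by linarith)] at hV
    have hsum : ∑ i, |x t i| ≤ 0 :=
      (hlow _).trans (mul_nonpos_of_nonneg_of_nonpos hK.le hV)
    ext i
    refine abs_nonpos_iff.1 (le_trans ?_ hsum)
    exact Finset.single_le_sum (f := fun i => |x t i|) (fun _ _ => abs_nonneg _)
      (Finset.mem_univ i)
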